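/- arXiv:1309.7941 — 2 statements merged into one kernel-verified Lean document; each statement's English description precedes it below -/
import Mathlib

section
/- For Q = 8490421583559688410706771261086, the set 𝔑_Q is non-empty; moreover, its minimum element is 39607528021345872635 = 5 × 100788283 × 78595501069. -/
/-- The power sum `S m k = 1^m + 2^m + ⋯ + k^m`. -/
def S (m k : ℕ) : ℕ := ∑ i ∈ Finset.Icc 1 k, i ^ m

/-- The set `𝔑_Q` of positive integers `n` with `S_{Qn}(Qn) ≡ n (mod Qn)`. -/
def Nset (Q : ℕ) : Set ℕ := {n | 0 < n ∧ S (Q * n) (Q * n) ≡ n [MOD Q * n]}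

lemma sum_range_natCast_zmod (N : ℕ) [NeZero N] (f : ZMod N → ZMod N) :
    ∑ i ∈ Finset.range N, f (i : ZMod N) = ∑ x : ZMod N, f x := by
  refine Finset.sum_bij' (fun i _ => (i : ZMod N)) (fun x _ => x.val) ?_ ?_ ?_ ?_ ?_
  · simp
  · intro x _
    simpa using ZMod.val_lt x
  · intro i hi
    exact ZMod.val_cast_of_lt (Finset.mem_range.mp hi)
  · simp
  · simp

lemma sum_range_mul_natCast_zmod (N t : ℕ) [NeZero N] (f : ZMod N → ZMod N) :
    ∑ i ∈ Finset.range (N * t), f (i : ZMod N) = t * ∑ x : ZMod N, f x := by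
  induction t with
  | zero => simp
  | succ t ih =>
    rw [Nat.mul_succ, Finset.sum_range_add, ih]
    have h : ∀ i : ℕ, ((N * t + i : ℕ) : ZMod N) = i := by
      intro i; simp
    simp only [h]
    rw [sum_range_natCast_zmod]
    push_cast
    ring

lemma S_cast_zmod (N t m : ℕ) [NeZero N] :
    ((S m (N * t) : ℕ) : ZMod N) = t * ∑ x : ZMod N, x ^ m := by
  rw [← sum_range_mul_natCast_zmod N t (fun x => x ^ m)]
  unfold S
  push_cast
  rw [← Finset.Ico_add_one_right_eq_Icc, Finset.sum_Ico_eq_sum_range, Nat.add_sub_cancel]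
  have h := Finset.sum_range_succ' (fun i : ℕ => (i : ZMod N) ^ m) (N * t)
  rw [Finset.sum_range_succ] at h
  simp only [Nat.cast_mul, CharP.cast_eq_zero, zero_mul, Nat.cast_zero] at h
  push_cast at h
  simpa [add_comm] using (add_right_cancel h).symm

lemma exists_coprime_pow_sub_one {p m : ℕ} (hp : p.Prime) (hm : ¬ p - 1 ∣ m) :
    ∃ g : ℕ, g.Coprime p ∧ ¬ (p : ℤ) ∣ (g : ℤ) ^ m - 1 := by
  have := Fact.mk hp
  have h : ¬ ∀ x : (ZMod p)ˣ, x ^ m = 1 := by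
    rw [FiniteField.forall_pow_eq_one_iff, ZMod.card]
    exact hm
  push Not at h
  obtain ⟨x, hx⟩ := h
  refine ⟨(x : ZMod p).val, ZMod.val_coe_unit_coprime x, fun hd => hx ?_⟩
  rw [← ZMod.intCast_zmod_eq_zero_iff_dvd] at hd
  push_cast at hd
  rw [ZMod.natCast_zmod_val, sub_eq_zero] at hd
  exact Units.ext (by simpa using hd)

/-- If `p - 1 ∤ m`, the `m`-th powers of the residues modulo a power of `p` sum to zero. -/
lemma sum_pow_zmod_prime_pow_eq_zero {p m : ℕ} (a : ℕ) (hp : p.Prime) (hm : ¬ p - 1 ∣ m)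
    [NeZero (p ^ a)] : ∑ x : ZMod (p ^ a), x ^ m = 0 := by
  obtain ⟨g, hg, hgm⟩ := exists_coprime_pow_sub_one hp hm
  have hu : IsUnit ((g : ZMod (p ^ a)) ^ m - 1) := by
    have hc : IsCoprime ((g : ℤ) ^ m - 1) ((p ^ a : ℕ) : ℤ) := by
      push_cast
      exact (((Nat.prime_iff_prime_int.mp hp).coprime_iff_not_dvd.mpr hgm).symm).pow_right
    obtain ⟨u, v, huv⟩ := hc
    have h := congrArg (Int.cast : ℤ → ZMod (p ^ a)) huv
    rw [Int.cast_add, Int.cast_mul v, Int.cast_natCast, ZMod.natCast_self, mul_zero, add_zero] at h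
    refine IsUnit.of_mul_eq_one (u : ZMod (p ^ a)) ?_
    push_cast at h
    rw [mul_comm]
    exact h
  have hre := Equiv.sum_comp (Units.mulLeft (ZMod.unitOfCoprime g (hg.pow_right a)))
    (fun x : ZMod (p ^ a) => x ^ m)
  simp only [Units.mulLeft_apply, ZMod.coe_unitOfCoprime, mul_pow] at hre
  rw [← Finset.mul_sum] at hre
  refine hu.mul_right_eq_zero.mp ?_
  rw [sub_mul, hre, one_mul, sub_self]

lemma prime_pow_dvd_S {p m k a : ℕ} (hp : p.Prime) (hm : ¬ p - 1 ∣ m) (hk : p ^ a ∣ k) :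
    p ^ a ∣ S m k := by
  have : NeZero (p ^ a) := ⟨pow_ne_zero _ hp.ne_zero⟩
  obtain ⟨t, rfl⟩ := hk
  rw [← ZMod.natCast_eq_zero_iff, S_cast_zmod, sum_pow_zmod_prime_pow_eq_zero a hp hm, mul_zero]

lemma sum_pow_zmod_prime_eq_neg_one {p m : ℕ} [Fact p.Prime] (hm0 : m ≠ 0) (hm : p - 1 ∣ m) :
    ∑ x : ZMod p, x ^ m = -1 := by
  rw [← Finset.sum_subset (Finset.subset_univ (Finset.univ \ {0})) (by simp [hm0]),
    Finset.sum_congr rfl (g := fun _ => (1 : ZMod p))]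
  · rw [Finset.sum_const, Finset.card_sdiff]
    simp [ZMod.card, Nat.cast_sub (Fact.out : p.Prime).one_le]
  · intro x hx
    obtain ⟨c, rfl⟩ := hm
    rw [pow_mul, ZMod.pow_card_sub_one_eq_one (by simpa using hx), one_pow]

/-- For a prime `p` with `p - 1 ∣ m`, the sum `S m k` is `-k/p` modulo `p`. -/
lemma prime_dvd_S_add {p m t : ℕ} (hp : p.Prime) (hm0 : m ≠ 0) (hm : p - 1 ∣ m) :
    p ∣ S m (p * t) + t := by
  have := Fact.mk hp
  rw [← ZMod.natCast_eq_zero_iff]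
  push_cast
  rw [S_cast_zmod, sum_pow_zmod_prime_eq_neg_one hm0 hm]
  ring

/-- If `p ∣ Q` is prime, every `n ∈ 𝔑_Q` satisfies `p - 1 ∣ Q n`. -/
lemma pred_dvd_of_mem_Nset {Q n p : ℕ} (hn : n ∈ Nset Q) (hp : p.Prime) (hpQ : p ∣ Q) :
    p - 1 ∣ Q * n := by
  by_contra h
  obtain ⟨hn0, hmod⟩ := hn
  obtain ⟨b, c, hc, rfl⟩ := Nat.exists_eq_pow_mul_and_not_dvd hn0.ne' p hp.ne_one
  have hd : p ^ (b + 1) ∣ Q * (p ^ b * c) := by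
    rw [pow_succ', ← mul_assoc]
    exact (mul_dvd_mul hpQ dvd_rfl).mul_right c
  have h1 := ((hmod.of_dvd hd).dvd_iff dvd_rfl).mp (prime_pow_dvd_S hp h hd)
  rw [pow_succ] at h1
  exact hc (Nat.dvd_of_mul_dvd_mul_left (pow_pos hp.pos b) h1)

lemma S_modEq_of_pred_dvd {p t n : ℕ} (hp : p.Prime) (ht : p * t ≠ 0) (hm : p - 1 ∣ p * t)
    (h : p ∣ n + t) : S (p * t) (p * t) ≡ n [MOD p] := by
  have h1 := prime_dvd_S_add (t := t) hp ht hm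
  exact Nat.ModEq.add_right_cancel' t
    (((Nat.modEq_zero_iff_dvd).mpr h1).trans ((Nat.modEq_zero_iff_dvd).mpr h).symm)

lemma S_modEq_of_not_pred_dvd {p k n : ℕ} (hp : p.Prime) (hk : p ∣ k) (hm : ¬ p - 1 ∣ k)
    (h : p ∣ n) : S k k ≡ n [MOD p] := by
  have h1 := prime_pow_dvd_S (a := 1) hp hm (by simpa using hk)
  rw [pow_one] at h1
  exact ((Nat.modEq_zero_iff_dvd).mpr h1).trans ((Nat.modEq_zero_iff_dvd).mpr h).symm

/-- `a ^ e % p` by repeated squaring, correct as soon as `e < 2 ^ k`. -/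
def powMod (p a : ℕ) : ℕ → ℕ → ℕ
  | 0, _ => 1 % p
  | k + 1, e => (powMod p a k (e / 2) ^ 2 * a ^ (e % 2)) % p

lemma powMod_eq (p a k e : ℕ) (h : e < 2 ^ k) : powMod p a k e = a ^ e % p := by
  induction k generalizing e with
  | zero =>
    obtain rfl : e = 0 := by simpa using h
    simp [powMod]
  | succ k ih =>
    rw [powMod, ih _ (by rw [pow_succ] at h; omega), Nat.mul_mod, ← Nat.pow_mod, ← Nat.mul_mod,
      ← pow_mul, ← pow_add, mul_comm, Nat.div_add_mod]

/-- Lucas primality test with a given list of prime factors of `p - 1`. -/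
lemma prime_of_lucas_list (p a k : ℕ) (L : List ℕ) (hk : p - 1 < 2 ^ k) (hL : ∀ q ∈ L, q.Prime)
    (hprod : L.prod = p - 1) (h1 : powMod p a k (p - 1) = 1 % p)
    (h2 : ∀ q ∈ L, powMod p a k ((p - 1) / q) ≠ 1 % p) :
    p.Prime := by
  refine lucas_primality p a ?_ ?_
  · rw [powMod_eq p a k _ hk] at h1
    exact_mod_cast (ZMod.natCast_eq_natCast_iff' (a ^ (p - 1)) 1 p).mpr h1
  · intro q hq hqd heq
    rw [← hprod] at hqd
    have hmem := mem_list_primes_of_dvd_prod hq.prime (fun r hr => (hL r hr).prime) hqd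
    refine h2 q hmem ?_
    rw [powMod_eq p a k _ ((Nat.div_le_self _ _).trans_lt hk)]
    refine (ZMod.natCast_eq_natCast_iff' _ 1 p).mp ?_
    exact_mod_cast heq

lemma prime_100788283 : Nat.Prime 100788283 := by norm_num

lemma prime_78595501069 : Nat.Prime 78595501069 :=
  prime_of_lucas_list 78595501069 2 40 [2, 2, 3, 3, 3, 3, 3, 7, 29, 398323]
    (by norm_num) (by norm_num) (by norm_num) (by decide +kernel) (by decide +kernel)

lemma prime_2217342227 : Nat.Prime 2217342227 :=
  prime_of_lucas_list 2217342227 2 40 [2, 11, 100788283] (by norm_num)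
    (by simp [Nat.prime_two, Nat.prime_eleven, prime_100788283])
    (by norm_num) (by decide +kernel) (by decide +kernel)

lemma prime_1729101023519 : Nat.Prime 1729101023519 :=
  prime_of_lucas_list 1729101023519 11 41 [2, 11, 78595501069] (by norm_num)
    (by simp [Nat.prime_two, Nat.prime_eleven, prime_78595501069])
    (by norm_num) (by decide +kernel) (by decide +kernel)

lemma mem_Nset_large :
    39607528021345872635 ∈ Nset 8490421583559688410706771261086 := by
  refine ⟨by norm_num, ?_⟩
  have key : ∀ p ∈ [2, 3, 11, 23, 31, 47059, 2217342227, 1729101023519, 5, 100788283, 78595501069],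
      S (8490421583559688410706771261086 * 39607528021345872635)
        (8490421583559688410706771261086 * 39607528021345872635) ≡
          39607528021345872635 [MOD p] := by
    have hdvd {p : ℕ} (hp : p.Prime)
        (h0 : p ∣ 8490421583559688410706771261086 * 39607528021345872635)
        (h1 : p - 1 ∣ 8490421583559688410706771261086 * 39607528021345872635)
        (h2 : p ∣ 39607528021345872635 +
          8490421583559688410706771261086 * 39607528021345872635 / p) :
        S (8490421583559688410706771261086 * 39607528021345872635)
          (8490421583559688410706771261086 * 39607528021345872635) ≡
            39607528021345872635 [MOD p] := by
      obtain ⟨t, ht⟩ := h0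
      rw [ht, Nat.mul_div_cancel_left t hp.pos] at h2
      rw [ht] at h1 ⊢
      exact S_modEq_of_pred_dvd hp (by rw [← ht]; norm_num) h1 h2
    simp only [List.forall_mem_cons]
    refine ⟨hdvd ?_ ?_ ?_ ?_, hdvd ?_ ?_ ?_ ?_, hdvd ?_ ?_ ?_ ?_, hdvd ?_ ?_ ?_ ?_,
      hdvd ?_ ?_ ?_ ?_, hdvd ?_ ?_ ?_ ?_, hdvd prime_2217342227 ?_ ?_ ?_,
      hdvd prime_1729101023519 ?_ ?_ ?_, S_modEq_of_not_pred_dvd ?_ ?_ ?_ ?_,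
      S_modEq_of_not_pred_dvd prime_100788283 ?_ ?_ ?_,
      S_modEq_of_not_pred_dvd prime_78595501069 ?_ ?_ ?_, by simp⟩ <;> norm_num
  have hM : 8490421583559688410706771261086 * 39607528021345872635 =
      [2, 3, 11, 23, 31, 47059, 2217342227, 1729101023519, 5, 100788283, 78595501069].prod := by
    norm_num
  have hco : [2, 3, 11, 23, 31, 47059, 2217342227, 1729101023519, 5, 100788283,
      78595501069].Pairwise Nat.Coprime := by
    norm_num
  generalize S (8490421583559688410706771261086 * 39607528021345872635)
        (8490421583559688410706771261086 * 39607528021345872635) = s at key ⊢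
  rw [hM]
  exact (Nat.modEq_list_prod_iff hco).mpr fun i => key _ (List.get_mem _ i)

theorem min_Nset_large :
    (Nset 8490421583559688410706771261086).Nonempty ∧
    IsLeast (Nset 8490421583559688410706771261086) 39607528021345872635 ∧
    (39607528021345872635 : ℕ) = 5 * 100788283 * 78595501069 := by
  refine ⟨⟨_, mem_Nset_large⟩, ⟨mem_Nset_large, fun n hn => ?_⟩, by norm_num⟩
  have hdvd {p r : ℕ} (hp : p.Prime) (hpQ : p ∣ 8490421583559688410706771261086)
      (hr : r ∣ p - 1) (hc : Nat.Coprime r 8490421583559688410706771261086) : r ∣ n :=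
    hc.dvd_of_dvd_mul_left (hr.trans (pred_dvd_of_mem_Nset hn hp hpQ))
  have h5 : 5 ∣ n := hdvd (p := 11) (by norm_num) (by norm_num) (by norm_num) (by norm_num)
  have h1 : 100788283 ∣ n := hdvd prime_2217342227 (by norm_num) (by norm_num) (by norm_num)
  have h2 : 78595501069 ∣ n := hdvd prime_1729101023519 (by norm_num) (by norm_num) (by norm_num)
  have h := Nat.Coprime.mul_dvd_of_dvd_of_dvd (by norm_num)
    (Nat.Coprime.mul_dvd_of_dvd_of_dvd (by norm_num) h5 h1) h2
  exact (Nat.le_of_dvd hn.1 h).trans' (by norm_num)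
end

section
/- For every weak primary pseudoperfect number Q such that 𝔑_Q is non-empty, the asymptotic density δ(𝔑_Q) of 𝔑_Q exists and is strictly positive. -/
/-- A set `A` of positive integers has asymptotic density `δ` if
`card (A ∩ [1, N]) / N → δ` as `N → ∞`. -/
def HasDensity (A : Set ℕ) (δ : ℝ) : Prop :=
  Filter.Tendsto (fun N : ℕ => ((A ∩ Set.Icc 1 N).ncard : ℝ) / N)
    Filter.atTop (nhds δ)

lemma sum_zmod_pow (p m : ℕ) [Fact p.Prime] (hm : m ≠ 0) :
    ∑ x : ZMod p, x ^ m = if (p - 1) ∣ m then -1 else 0 := by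
  classical
  rw [← Finset.add_sum_erase _ _ (Finset.mem_univ (0 : ZMod p)), zero_pow hm, zero_add]
  have h := FiniteField.sum_pow_units (ZMod p) m
  rw [ZMod.card] at h
  rw [← h]
  symm
  refine Finset.sum_bij (fun x _ => (x : ZMod p)) (by simp) (fun _ _ _ _ h => Units.ext h) ?_
    (by simp)
  intro b hb
  exact ⟨Units.mk0 b (Finset.ne_of_mem_erase hb), Finset.mem_univ _, rfl⟩

lemma sum_range_zmod (p : ℕ) [NeZero p] {M : Type*} [AddCommMonoid M] (g : ZMod p → M) :
    ∑ i ∈ Finset.range p, g i = ∑ x, g x := by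
  refine Finset.sum_nbij' (fun i => (i : ZMod p)) ZMod.val (by simp) ?_ ?_ (by simp) (by simp)
  · intro x _
    exact Finset.mem_range.2 (ZMod.val_lt x)
  · intro i hi
    exact ZMod.val_cast_of_lt (Finset.mem_range.1 hi)

lemma prime_dvd_sum_range_pow {p m : ℕ} (hp : p.Prime) (hm : m ≠ 0) :
    (p : ℤ) ∣ ∑ i ∈ Finset.range p, (i : ℤ) ^ m + if (p - 1) ∣ m then 1 else 0 := by
  have : Fact p.Prime := ⟨hp⟩
  rw [← ZMod.intCast_zmod_eq_zero_iff_dvd]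
  push_cast
  rw [sum_range_zmod p (fun x : ZMod p => x ^ m), sum_zmod_pow p m hm]
  split_ifs <;> simp

/-- If `p ^ a ∣ k`, then `i ^ k` modulo `p ^ a` depends only on `i` modulo `p`. -/
lemma prime_pow_dvd_pow_sub_pow {p a k : ℕ} (hk : p ^ a ∣ k) {x y : ℤ}
    (h : (p : ℤ) ∣ x - y) : (p : ℤ) ^ a ∣ x ^ k - y ^ k := by
  obtain ⟨c, rfl⟩ := hk
  rw [pow_mul, pow_mul]
  exact ((pow_dvd_pow _ a.le_succ).trans (dvd_sub_pow_of_dvd_sub h a)).trans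
    (sub_dvd_pow_sub_pow _ _ c)

lemma dvd_sum_range_mul_sub {d : ℤ} {g : ℕ → ℤ} {p : ℕ} (h : ∀ q i, d ∣ g (p * q + i) - g i)
    (q : ℕ) : d ∣ ∑ i ∈ Finset.range (p * q), g i - q * ∑ i ∈ Finset.range p, g i := by
  induction q with
  | zero => simp
  | succ q ih =>
    have key : d ∣ ∑ i ∈ Finset.range p, (g (p * q + i) - g i) :=
      Finset.dvd_sum fun i _ => h q i
    rw [Finset.sum_sub_distrib] at key
    rw [Nat.mul_succ, Finset.sum_range_add]
    rw [show ∑ i ∈ Finset.range (p * q), g i + ∑ i ∈ Finset.range p, g (p * q + i) -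
        ((q + 1 : ℕ) : ℤ) * ∑ i ∈ Finset.range p, g i =
        (∑ i ∈ Finset.range (p * q), g i - q * ∑ i ∈ Finset.range p, g i) +
        (∑ i ∈ Finset.range p, g (p * q + i) - ∑ i ∈ Finset.range p, g i) by push_cast; ring]
    exact dvd_add ih key

lemma S_eq_sum_range {m : ℕ} (hm : m ≠ 0) (k : ℕ) :
    S m k = ∑ i ∈ Finset.range k, i ^ m + k ^ m := by
  rw [← Finset.sum_range_succ, Finset.sum_range_succ', zero_pow hm, add_zero, S,
    Finset.range_eq_Ico, Finset.sum_Ico_add' (fun i => i ^ m) 0 k 1]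
  rfl

/-- The local form, at a prime `p`, of Carlitz's congruence for `S k k`. -/
lemma prime_pow_dvd_S_self_add {p a k : ℕ} (hp : p.Prime) (hk0 : k ≠ 0) (ha : p ^ (a + 1) ∣ k) :
    (p : ℤ) ^ (a + 1) ∣ (S k k : ℤ) + if (p - 1) ∣ k then ((k / p : ℕ) : ℤ) else 0 := by
  have hdk : (p : ℤ) ^ (a + 1) ∣ (k : ℤ) ^ k := by
    exact_mod_cast ha.trans (dvd_pow_self k hk0)
  have hpk : p * (k / p) = k := Nat.mul_div_cancel' ((dvd_pow_self p a.succ_ne_zero).trans ha)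
  have h1 := dvd_sum_range_mul_sub (d := (p : ℤ) ^ (a + 1)) (g := fun i => (i : ℤ) ^ k) (p := p)
    (fun q i => prime_pow_dvd_pow_sub_pow ha ⟨q, by push_cast; ring⟩) (k / p)
  rw [hpk] at h1
  have h2 : (p : ℤ) ^ (a + 1) ∣ ((k / p : ℕ) : ℤ) *
      (∑ i ∈ Finset.range p, (i : ℤ) ^ k + if (p - 1) ∣ k then 1 else 0) := by
    rw [pow_succ]
    refine mul_dvd_mul ?_ (prime_dvd_sum_range_pow hp hk0)
    have : p ^ a ∣ k / p := by
      rw [← hpk, pow_succ'] at ha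
      exact Nat.dvd_of_mul_dvd_mul_left hp.pos ha
    exact_mod_cast this
  have h3 := dvd_add (dvd_add h1 h2) hdk
  rw [S_eq_sum_range hk0]
  refine h3.trans (dvd_of_eq ?_)
  push_cast
  split_ifs <;> ring

lemma dvd_div_add_one_of_weak {Q : ℕ} (hw : (∑ p ∈ Q.primeFactors, Q / p) + 1 ≡ 0 [MOD Q])
    {p : ℕ} (hp : p.Prime) (hpQ : p ∣ Q) : p ∣ Q / p + 1 := by
  rcases eq_or_ne Q 0 with rfl | hQ
  · simp [Nat.ModEq] at hw
  have h1 : p ∣ (∑ q ∈ Q.primeFactors, Q / q) + 1 :=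
    hpQ.trans ((Nat.modEq_zero_iff_dvd).1 hw)
  rw [← Finset.add_sum_erase _ _ (Nat.mem_primeFactors.2 ⟨hp, hpQ, hQ⟩), add_right_comm] at h1
  refine (Nat.dvd_add_left (Finset.dvd_sum fun q hq => ?_)).1 h1
  obtain ⟨hne, hq⟩ := Finset.mem_erase.1 hq
  obtain ⟨hq, hqQ, -⟩ := Nat.mem_primeFactors.1 hq
  refine ((Nat.coprime_primes hp hq).2 hne.symm).dvd_of_dvd_mul_left ?_
  rwa [Nat.mul_div_cancel' hqQ]

/-- For a weak primary pseudoperfect number `Q`, a positive integer `n` is in `Nset Q` if and only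
if the primes `p ∣ Q * n` with `p - 1 ∣ Q * n` are exactly the prime divisors of `Q`. -/
lemma mem_Nset_iff {Q : ℕ} (hQ : 0 < Q)
    (hw : (∑ p ∈ Q.primeFactors, Q / p) + 1 ≡ 0 [MOD Q]) {n : ℕ} (hn : 0 < n) :
    n ∈ Nset Q ↔ (∀ p, p.Prime → p ∣ Q → (p - 1) ∣ Q * n) ∧
      ∀ p, p.Prime → ¬ p ∣ Q → p ∣ n → ¬ (p - 1) ∣ Q * n := by
  have hk0 : Q * n ≠ 0 := (Nat.mul_pos hQ hn).ne'
  have hloc : ∀ p a : ℕ, p.Prime → p ^ (a + 1) ∣ Q * n →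
      ((p : ℤ) ^ (a + 1) ∣ (S (Q * n) (Q * n) : ℤ) - n ↔
        p ^ (a + 1) ∣ (if (p - 1) ∣ Q * n then (Q * n) / p else 0) + n) := by
    intro p a hp ha
    have h := prime_pow_dvd_S_self_add hp hk0 ha
    rw [← Int.natCast_dvd_natCast]
    rw [← dvd_sub_right h (c := (S (Q * n) (Q * n) : ℤ) - n)]
    push_cast
    congr! 1
    split_ifs <;> ring
  have hmem : n ∈ Nset Q ↔ ((Q * n : ℕ) : ℤ) ∣ (S (Q * n) (Q * n) : ℤ) - n := by
    rw [← Nat.modEq_iff_dvd]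
    exact ⟨fun h => h.2.symm, fun h => ⟨hn, h.symm⟩⟩
  rw [hmem]
  constructor
  · intro h
    constructor
    · intro p hp hpQ
      by_contra hcon
      obtain ⟨a, c, hc, hac⟩ := Nat.exists_eq_pow_mul_and_not_dvd hk0 p hp.ne_one
      obtain _ | a := a
      · apply hc
        rw [pow_zero, one_mul] at hac
        exact hac ▸ hpQ.mul_right n
      have hd : p ^ (a + 1) ∣ Q * n := ⟨c, hac⟩
      have h2 := (hloc p a hp hd).1 (dvd_trans (by exact_mod_cast hd) h)
      rw [if_neg hcon, zero_add] at h2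
      have h3 : p ^ (a + 1) * p ∣ Q * n := by rw [mul_comm Q]; exact mul_dvd_mul h2 hpQ
      rw [hac] at h3
      exact hc (Nat.dvd_of_mul_dvd_mul_left (pow_pos hp.pos _) h3)
    · intro p hp hpQ hpn hcon
      obtain ⟨a, c, hc, hac⟩ := Nat.exists_eq_pow_mul_and_not_dvd hn.ne' p hp.ne_one
      obtain _ | a := a
      · apply hc
        rw [pow_zero, one_mul] at hac
        exact hac ▸ hpn
      have hdn : p ^ (a + 1) ∣ n := ⟨c, hac⟩
      have hd : p ^ (a + 1) ∣ Q * n := hdn.mul_left Q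
      have h2 := (hloc p a hp hd).1 (dvd_trans (by exact_mod_cast hd) h)
      rw [if_pos hcon, Nat.dvd_add_left hdn] at h2
      have h3 : p ^ (a + 1) * p ∣ Q * n := by
        rw [mul_comm, ← Nat.mul_div_cancel' (hpn.mul_left Q)]
        exact mul_dvd_mul_left p h2
      rw [hac, mul_left_comm] at h3
      rcases hp.dvd_mul.1 (Nat.dvd_of_mul_dvd_mul_left (pow_pos hp.pos _) h3) with h4 | h4
      · exact hpQ h4
      · exact hc h4
  · rintro ⟨hA, hB⟩
    rw [← Int.dvd_natAbs, Int.natCast_dvd_natCast, Nat.dvd_iff_prime_pow_dvd_dvd]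
    intro p k hp hd
    obtain _ | a := k
    · simp
    rw [← Int.natCast_dvd_natCast, Int.dvd_natAbs, Nat.cast_pow, hloc p a hp hd]
    by_cases hpQ : p ∣ Q
    · rw [if_pos (hA p hp hpQ)]
      have hQ1 := dvd_div_add_one_of_weak hw hp hpQ
      obtain ⟨R, rfl⟩ := hpQ
      rw [Nat.mul_div_cancel_left _ hp.pos] at hQ1
      rw [mul_assoc, Nat.mul_div_cancel_left _ hp.pos]
      have hR : (p ^ (a + 1)).Coprime R := by
        refine Nat.Coprime.pow_left _ ((Nat.Prime.coprime_iff_not_dvd hp).2 fun hpR => ?_)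
        exact hp.one_lt.ne' (Nat.dvd_one.1 ((Nat.dvd_add_right hpR).1 hQ1))
      have h1 : p ^ (a + 1) ∣ p * n :=
        hR.dvd_of_dvd_mul_left (by rwa [mul_left_comm, ← mul_assoc])
      rw [← Nat.succ_mul]
      exact h1.trans (mul_dvd_mul_right hQ1 n)
    · have hdn : p ^ (a + 1) ∣ n :=
        (Nat.Coprime.pow_left _ ((Nat.Prime.coprime_iff_not_dvd hp).2 hpQ)).dvd_of_dvd_mul_left hd
      rw [if_neg (hB p hp hpQ ((dvd_pow_self p a.succ_ne_zero).trans hdn)), zero_add]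
      exact hdn

lemma exists_tendsto_count_div_of_periodic {P : ℕ → Prop} [DecidablePred P] {T : ℕ} (hT : 0 < T)
    (hP : Function.Periodic P T) :
    ∃ δ : ℝ, Filter.Tendsto (fun N : ℕ => (((Finset.Icc 1 N).filter P).card : ℝ) / N)
      Filter.atTop (nhds δ) := by
  set C : ℕ → ℕ := fun N => ((Finset.Icc 1 N).filter P).card
  have hC : ∀ N, C (N + T) = C N + Nat.count P T := by
    intro N
    have h := Nat.filter_Ico_card_eq_of_periodic (N + 1) T P hP
    rw [← h]
    simp only [C]
    rw [← Finset.card_union_of_disjoint, ← Finset.filter_union]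
    · congr 2
      ext x
      simp only [Finset.mem_union, Finset.mem_Icc, Finset.mem_Ico]
      omega
    · rw [Finset.disjoint_left]
      intro x hx hx'
      simp only [Finset.mem_filter, Finset.mem_Icc, Finset.mem_Ico] at hx hx'
      omega
  set δ : ℝ := (Nat.count P T : ℝ) / T
  have hT' : (T : ℝ) ≠ 0 := by positivity
  set D : ℕ → ℝ := fun N => C N - N * δ
  have hD : Function.Periodic D T := by
    intro N
    simp only [D, hC, δ]
    push_cast
    field_simp
    ring
  have hbound : ∀ N, |D N| ≤ ∑ i ∈ Finset.range T, |D i| := by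
    intro N
    rw [← hD.map_mod_nat N]
    exact Finset.single_le_sum (f := fun i => |D i|) (fun i _ => abs_nonneg _)
      (Finset.mem_range.2 (Nat.mod_lt N hT))
  refine ⟨δ, ?_⟩
  have h0 : Filter.Tendsto (fun N : ℕ => D N / N) Filter.atTop (nhds 0) :=
    tendsto_bdd_div_atTop_nhds_zero (b := -∑ i ∈ Finset.range T, |D i|)
      (B := ∑ i ∈ Finset.range T, |D i|)
      (Filter.Eventually.of_forall fun N => (abs_le.1 (hbound N)).1)
      (Filter.Eventually.of_forall fun N => (abs_le.1 (hbound N)).2)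
      tendsto_natCast_atTop_atTop
  have h1 := h0.add_const δ
  rw [zero_add] at h1
  refine h1.congr' ?_
  filter_upwards [Filter.eventually_gt_atTop 0] with N hN
  have : (N : ℝ) ≠ 0 := by positivity
  simp only [D]
  field_simp
  ring

lemma card_filter_dvd_mul_add_one_le {e : ℕ} (he : 0 < e) (M K : ℕ) :
    (((Finset.range K).filter fun k => e ∣ M * k + 1).card : ℝ) ≤ K * (1 / e) + 1 := by
  rcases ((Finset.range K).filter fun k => e ∣ M * k + 1).eq_empty_or_nonempty with h | ⟨k₀, hk₀⟩
  · rw [h]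
    simp only [Finset.card_empty, Nat.cast_zero]
    positivity
  have hk₀ := (Finset.mem_filter.1 hk₀).2
  have hcop : e.gcd M = 1 := by
    have h1 : e.gcd M ∣ M * k₀ := (Nat.gcd_dvd_right e M).mul_right k₀
    exact Nat.dvd_one.1 ((Nat.dvd_add_right h1).1 ((Nat.gcd_dvd_left e M).trans hk₀))
  have hle : ((Finset.range K).filter fun k => e ∣ M * k + 1).card ≤ K / e + 1 := by
    calc _ ≤ ((Finset.range K).filter fun k => k ≡ k₀ [MOD e]).card := by
          refine Finset.card_le_card fun k hk => ?_
          simp only [Finset.mem_filter] at hk ⊢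
          refine ⟨hk.1, Nat.ModEq.cancel_left_of_coprime hcop (Nat.ModEq.add_right_cancel' 1 ?_)⟩
          exact ((Nat.modEq_zero_iff_dvd).2 hk.2).trans ((Nat.modEq_zero_iff_dvd).2 hk₀).symm
      _ ≤ _ := by
          rw [← Nat.count_eq_card_filter_range, Nat.count_modEq_card K he]
          split_ifs <;> omega
  calc _ ≤ ((K / e + 1 : ℕ) : ℝ) := by exact_mod_cast hle
    _ ≤ _ := by
      push_cast
      have := Nat.cast_div_le (α := ℝ) (m := K) (n := e)
      rw [mul_one_div]
      linarith

open Classical in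
/-- The number of `n ∈ [1, N]` that are not divisible by any `f i` with `i ∈ s`. -/
noncomputable def sieveCount {ι : Type*} (f : ι → ℕ) (s : Set ι) (N : ℕ) : ℕ :=
  ((Finset.Icc 1 N).filter fun n => ∀ i ∈ s, ¬ f i ∣ n).card

section Sieve

variable {ι : Type*} {f : ι → ℕ}

lemma sieveCount_anti {s t : Set ι} (h : s ⊆ t) (N : ℕ) :
    sieveCount f t N ≤ sieveCount f s N := by
  refine Finset.card_le_card fun n hn => ?_
  simp only [Finset.mem_filter] at hn ⊢
  exact ⟨hn.1, fun i hi => hn.2 i (h hi)⟩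

lemma exists_tendsto_sieveCount_div (hf : ∀ i, 2 ≤ f i) (s : Finset ι) :
    ∃ δ : ℝ, Filter.Tendsto (fun N : ℕ => (sieveCount f s N : ℝ) / N) Filter.atTop (nhds δ) := by
  refine @exists_tendsto_count_div_of_periodic _ (Classical.decPred _) (∏ i ∈ s, f i)
    (Finset.prod_pos fun i _ => by have := hf i; omega) fun n => ?_
  refine propext (forall₂_congr fun i hi => not_congr ?_)
  exact Nat.dvd_add_left (Finset.dvd_prod_of_mem f hi)

lemma sieveCount_le_univ_add {ε : ℝ} {s : Finset ι}
    (hs : ∀ t : Finset ι, Disjoint t s → ∑ i ∈ t, (1 / f i : ℝ) < ε) (N : ℕ) :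
    (sieveCount f s N : ℝ) ≤ sieveCount f Set.univ N + N * ε := by
  classical
  set B : Finset ℕ := (Finset.Icc 1 N).filter fun n =>
    (∀ i ∈ s, ¬ f i ∣ n) ∧ ∃ i, f i ∣ n with hB
  have hBi : ∀ n : B, ∃ i, f i ∣ n := fun n => (Finset.mem_filter.1 n.2).2.2
  choose g hg using hBi
  set t : Finset ι := B.attach.image g with ht
  have hts : Disjoint t s := by
    rw [Finset.disjoint_left]
    intro i hi his
    obtain ⟨n, -, rfl⟩ := Finset.mem_image.1 hi
    exact (Finset.mem_filter.1 n.2).2.1 _ his (hg n)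
  have hBt : B ⊆ t.biUnion fun i => (Finset.Ioc 0 N).filter (f i ∣ ·) := by
    intro n hn
    have hn' := Finset.mem_Icc.1 (Finset.mem_filter.1 hn).1
    exact Finset.mem_biUnion.2 ⟨g ⟨n, hn⟩, Finset.mem_image_of_mem _ (Finset.mem_attach _ _),
      Finset.mem_filter.2 ⟨Finset.mem_Ioc.2 ⟨hn'.1, hn'.2⟩, hg ⟨n, hn⟩⟩⟩
  have hBcard : (B.card : ℝ) ≤ N * ε := by
    calc (B.card : ℝ) ≤ ((∑ i ∈ t, N / f i : ℕ) : ℝ) := by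
          refine Nat.cast_le.2 (((Finset.card_le_card hBt).trans Finset.card_biUnion_le).trans ?_)
          exact Finset.sum_le_sum fun i _ => (Nat.Ioc_filter_dvd_card_eq_div N (f i)).le
      _ ≤ N * ∑ i ∈ t, (1 / f i : ℝ) := by
          rw [Nat.cast_sum, Finset.mul_sum]
          refine Finset.sum_le_sum fun i _ => ?_
          rw [mul_one_div]
          exact Nat.cast_div_le
      _ ≤ N * ε := by
          have := (hs t hts).le
          gcongr
  have hle : sieveCount f s N ≤ sieveCount f Set.univ N + B.card := by
    unfold sieveCount
    refine (Finset.card_le_card fun n hn => ?_).trans (Finset.card_union_le _ _)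
    simp only [hB, Finset.mem_union, Finset.mem_filter, Finset.mem_coe] at hn ⊢
    by_cases h : ∃ i, f i ∣ n
    · exact Or.inr ⟨hn.1, hn.2, h⟩
    · exact Or.inl ⟨hn.1, fun i _ hi => h ⟨i, hi⟩⟩
  calc (sieveCount f s N : ℝ) ≤ sieveCount f Set.univ N + B.card := by exact_mod_cast hle
    _ ≤ _ := by gcongr

/-- The lower bound comes from the progression of the `n ≡ 1` modulo `∏ i ∈ s, f i`. -/
lemma le_sieveCount (hf : ∀ i, 2 ≤ f i) {s : Finset ι}
    (hs : ∀ t : Finset ι, Disjoint t s → ∑ i ∈ t, (1 / f i : ℝ) < 1 / 2) (u : Finset ι) {K N : ℕ}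
    (hK : (∏ i ∈ s, f i) * K ≤ N) : (K : ℝ) / 2 - u.card ≤ sieveCount f u N := by
  classical
  set M := ∏ i ∈ s, f i with hM
  have hM0 : 0 < M := Finset.prod_pos fun i _ => by have := hf i; omega
  set t := u \ s with ht
  have hts : Disjoint t s := Finset.sdiff_disjoint
  set G := (Finset.range K).filter fun k => ∀ i ∈ t, ¬ f i ∣ M * k + 1 with hG
  have h1 : G.card ≤ sieveCount f u N := by
    refine Finset.card_le_card_of_injOn (fun k => M * k + 1) (fun k hk => ?_) ?_
    · simp only [hG, Finset.coe_filter, Finset.mem_range, Set.mem_ofPred_eq, Finset.mem_Icc,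
        Finset.mem_coe] at hk ⊢
      refine ⟨⟨by omega, ?_⟩, fun i hi => ?_⟩
      · have : M * (k + 1) ≤ M * K := Nat.mul_le_mul_left M hk.1
        rw [Nat.mul_succ] at this
        omega
      · by_cases his : i ∈ s
        · intro hdvd
          have hiM : f i ∣ M * k := (Finset.dvd_prod_of_mem f his).mul_right k
          have := Nat.dvd_one.1 ((Nat.dvd_add_right hiM).1 hdvd)
          have := hf i
          omega
        · exact hk.2 i (Finset.mem_sdiff.2 ⟨hi, his⟩)
    · intro a _ b _ hab
      exact Nat.eq_of_mul_eq_mul_left hM0 (Nat.succ_injective hab)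
  have h2 : K ≤ G.card + ∑ i ∈ t, ((Finset.range K).filter fun k => f i ∣ M * k + 1).card := by
    calc K = (Finset.range K).card := (Finset.card_range K).symm
      _ ≤ (G ∪ t.biUnion fun i => (Finset.range K).filter fun k => f i ∣ M * k + 1).card := by
          refine Finset.card_le_card fun k hk => ?_
          simp only [hG, Finset.mem_union, Finset.mem_filter, Finset.mem_biUnion]
          by_cases h : ∃ i ∈ t, f i ∣ M * k + 1
          · obtain ⟨i, hi, hd⟩ := h
            exact Or.inr ⟨i, hi, hk, hd⟩
          · exact Or.inl ⟨hk, fun i hi hd => h ⟨i, hi, hd⟩⟩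
      _ ≤ _ := (Finset.card_union_le _ _).trans (by gcongr; exact Finset.card_biUnion_le)
  have h3 : (K : ℝ) ≤ G.card + ∑ i ∈ t, (K * (1 / f i : ℝ) + 1) := by
    calc (K : ℝ) ≤ G.card +
          ∑ i ∈ t, (((Finset.range K).filter fun k => f i ∣ M * k + 1).card : ℝ) := by
          exact_mod_cast h2
      _ ≤ _ := by
          gcongr with i
          exact card_filter_dvd_mul_add_one_le (by have := hf i; omega) M K
  rw [Finset.sum_add_distrib, ← Finset.mul_sum, Finset.sum_const, nsmul_one] at h3
  have h4 : (K : ℝ) * ∑ i ∈ t, (1 / f i : ℝ) ≤ K * (1 / 2) := by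
    have := (hs t hts).le
    gcongr
  have h5 : (t.card : ℝ) ≤ u.card := by exact_mod_cast Finset.card_le_card Finset.sdiff_subset
  have h6 : (G.card : ℝ) ≤ sieveCount f u N := by exact_mod_cast h1
  linarith

/-- If `∑ 1 / f i` converges and every `f i` is at least `2`, then the integers that are not
divisible by any `f i` have a positive density. -/
lemma exists_pos_tendsto_sieveCount_univ_div (hf : ∀ i, 2 ≤ f i)
    (hs : Summable fun i => (1 / f i : ℝ)) :
    ∃ δ : ℝ, 0 < δ ∧
      Filter.Tendsto (fun N : ℕ => (sieveCount f Set.univ N : ℝ) / N) Filter.atTop (nhds δ) := by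
  classical
  have hvan : ∀ ε : ℝ, 0 < ε → ∃ s : Finset ι, ∀ t : Finset ι, Disjoint t s →
      ∑ i ∈ t, (1 / f i : ℝ) < ε := fun ε hε =>
    summable_iff_vanishing.1 hs (Set.Iio ε) (Iio_mem_nhds hε)
  have hcauchy : CauchySeq fun N : ℕ => (sieveCount f Set.univ N : ℝ) / N := by
    rw [Metric.cauchySeq_iff]
    intro ε hε
    obtain ⟨s, hs⟩ := hvan (ε / 3) (by positivity)
    have hclose : ∀ N : ℕ, 0 < N →
        |(sieveCount f Set.univ N : ℝ) / N - (sieveCount f s N : ℝ) / N| ≤ ε / 3 := by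
      intro N hN
      have hN' : (0 : ℝ) < N := by exact_mod_cast hN
      have h1 := sieveCount_le_univ_add hs N
      have h2 : (sieveCount f Set.univ N : ℝ) ≤ sieveCount f s N := by
        exact_mod_cast sieveCount_anti (Set.subset_univ _) N
      rw [← sub_div, abs_le, le_div_iff₀ hN', div_le_iff₀ hN']
      constructor <;> nlinarith
    obtain ⟨d, hd⟩ := exists_tendsto_sieveCount_div hf s
    obtain ⟨N₀, hN₀⟩ := Metric.cauchySeq_iff.1 hd.cauchySeq (ε / 3) (by positivity)
    refine ⟨N₀ + 1, fun m hm n hn => ?_⟩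
    have h1 := hN₀ m (by omega) n (by omega)
    have h2 := hclose m (by omega)
    have h3 := hclose n (by omega)
    rw [Real.dist_eq] at h1 ⊢
    rw [abs_lt] at h1 ⊢
    rw [abs_le] at h2 h3
    constructor <;> linarith [h1.1, h1.2, h2.1, h2.2, h3.1, h3.2]
  obtain ⟨δ, hδ⟩ := cauchySeq_tendsto_of_complete hcauchy
  refine ⟨δ, ?_, hδ⟩
  obtain ⟨s, hs2⟩ := hvan (1 / 2) (by positivity)
  set M := ∏ i ∈ s, f i with hM
  have hM0 : 0 < M := Finset.prod_pos fun i _ => by have := hf i; omega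
  have hMr : (0 : ℝ) < M := by exact_mod_cast hM0
  obtain ⟨u, hu⟩ := hvan (1 / (4 * M)) (by positivity)
  have hev : ∀ᶠ N : ℕ in Filter.atTop,
      1 / (8 * M : ℝ) ≤ (sieveCount f Set.univ N : ℝ) / N := by
    filter_upwards [Filter.eventually_ge_atTop (8 * M * (u.card + 1))] with N hN
    have hNr : (8 * M * (u.card + 1) : ℝ) ≤ N := by exact_mod_cast hN
    have hN0 : (0 : ℝ) < N := lt_of_lt_of_le (by positivity) hNr
    have h1 := le_sieveCount hf hs2 u (Nat.mul_div_le N M)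
    have h2 := sieveCount_le_univ_add hu N
    have h3 : (N : ℝ) / M - 1 ≤ (N / M : ℕ) := by
      have : N ≤ M * (N / M + 1) := by
        rw [Nat.mul_succ]
        have := Nat.div_add_mod N M
        have := Nat.mod_lt N hM0
        omega
      have : (N : ℝ) ≤ M * ((N / M : ℕ) + 1) := by exact_mod_cast this
      rw [sub_le_iff_le_add, div_le_iff₀ hMr]
      linarith
    have h4 : (u.card : ℝ) + 1 ≤ N * (1 / (8 * M)) := by
      rw [mul_one_div, le_div_iff₀ (by positivity)]
      linarith
    rw [le_div_iff₀ hN0]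
    have e1 : (N : ℝ) * (1 / (4 * M)) = N / M / 4 := by field_simp
    have e2 : (N : ℝ) * (1 / (8 * M)) = N / M / 8 := by field_simp
    rw [mul_comm]
    linarith
  exact lt_of_lt_of_le (by positivity) (ge_of_tendsto hδ hev)

end Sieve

lemma dvd_mul_iff_div_gcd_dvd {a : ℕ} (ha : 0 < a) (b c : ℕ) :
    a ∣ b * c ↔ a / a.gcd b ∣ c := by
  rw [← Nat.dvd_gcd_mul_iff_dvd_mul,
    Nat.div_dvd_iff_dvd_mul (Nat.gcd_dvd_left a b) (Nat.gcd_pos_of_pos_left b ha)]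

lemma tendsto_natDiv_div_atTop {L : ℕ} (hL : 0 < L) :
    Filter.Tendsto (fun N : ℕ => ((N / L : ℕ) : ℝ) / N) Filter.atTop (nhds (1 / L)) := by
  have h := (tendsto_nat_floor_mul_div_atTop (R := ℝ) (a := 1 / L) (by positivity)).comp
    tendsto_natCast_atTop_atTop
  refine h.congr fun N => ?_
  simp only [Function.comp_apply]
  rw [one_div_mul_eq_div, Nat.floor_div_eq_div]

lemma hasDensity_of_mem_iff {A : Set ℕ} {L : ℕ} (hL : 0 < L) {ι : Type*} {f : ι → ℕ} {δ : ℝ}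
    (hA : ∀ n, n ∈ A ↔ ∃ m, n = L * m ∧ 0 < m ∧ ∀ i, ¬ f i ∣ m)
    (hδ : Filter.Tendsto (fun N : ℕ => (sieveCount f Set.univ N : ℝ) / N) Filter.atTop
      (nhds δ)) : HasDensity A (δ * (1 / L)) := by
  classical
  have hcard : ∀ N, (A ∩ Set.Icc 1 N).ncard = sieveCount f Set.univ (N / L) := by
    intro N
    rw [sieveCount, ← Finset.card_image_of_injective _ (mul_right_injective₀ hL.ne'),
      ← Set.ncard_coe_finset]
    congr 1
    ext n
    simp only [Set.mem_inter_iff, hA, Set.mem_Icc, Finset.coe_image, Set.mem_image,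
      Finset.mem_coe, Finset.mem_filter, Finset.mem_Icc, Set.mem_univ, true_imp_iff,
      Nat.le_div_iff_mul_le hL]
    constructor
    · rintro ⟨⟨m, rfl, hm, h⟩, -, hN⟩
      exact ⟨m, ⟨⟨hm, by rwa [mul_comm]⟩, h⟩, rfl⟩
    · rintro ⟨m, ⟨⟨hm, hN⟩, h⟩, rfl⟩
      exact ⟨⟨m, rfl, hm, h⟩, Nat.mul_pos hL hm, by rwa [mul_comm]⟩
  have h1 := (hδ.comp (Nat.tendsto_div_const_atTop hL.ne')).mul (tendsto_natDiv_div_atTop hL)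
  refine h1.congr' ?_
  filter_upwards [Filter.eventually_ge_atTop L] with N hN
  have h2 : ((N / L : ℕ) : ℝ) ≠ 0 := by
    exact_mod_cast (Nat.div_pos hN hL).ne'
  simp only [Function.comp_apply]
  rw [hcard, div_mul_div_cancel₀ h2]

theorem density_pos (Q : ℕ) (hQ : 0 < Q)
    (hw : (∑ p ∈ Q.primeFactors, Q / p) + 1 ≡ 0 [MOD Q])
    (hne : (Nset Q).Nonempty) :
    ∃ δ : ℝ, HasDensity (Nset Q) δ ∧ 0 < δ := by
  set g : ℕ → ℕ := fun p => (p - 1) / (p - 1).gcd Q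
  set L := Q.primeFactors.lcm g
  set d : ℕ → ℕ := fun p => p.lcm (g p)
  set f : {p : ℕ // p.Prime ∧ ¬ p ∣ Q} → ℕ := fun p => d p / (d p).gcd L
  have hpred : ∀ p : ℕ, p.Prime → 0 < p - 1 := fun p hp => by
    have := hp.two_le
    omega
  have hgdvd : ∀ p n : ℕ, p.Prime → ((p - 1) ∣ Q * n ↔ g p ∣ n) := fun p n hp =>
    dvd_mul_iff_div_gcd_dvd (hpred p hp) Q n
  have hgpos : ∀ p : ℕ, p.Prime → 0 < g p := fun p hp =>
    Nat.div_gcd_pos_of_pos_left Q (hpred p hp)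
  have hL : 0 < L := Nat.pos_of_ne_zero <| Finset.lcm_ne_zero_iff.2 fun p hp =>
    (hgpos p (Nat.prime_of_mem_primeFactors hp)).ne'
  have hdpos : ∀ p : ℕ, p.Prime → 0 < d p := fun p hp => Nat.lcm_pos hp.pos (hgpos p hp)
  have hmem : ∀ n, 0 < n → (n ∈ Nset Q ↔ L ∣ n ∧ ∀ p, p.Prime → ¬ p ∣ Q → ¬ d p ∣ n) := by
    intro n hn
    rw [mem_Nset_iff hQ hw hn, Finset.lcm_dvd_iff]
    refine and_congr ⟨fun h p hp => ?_, fun h p hp hpQ => ?_⟩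
      (forall_congr' fun p => forall₂_congr fun hp hpQ => ?_)
    · have hpp := Nat.prime_of_mem_primeFactors hp
      exact (hgdvd p n hpp).1 (h p hpp (Nat.dvd_of_mem_primeFactors hp))
    · exact (hgdvd p n hp).2 (h p (Nat.mem_primeFactors.2 ⟨hp, hpQ, hQ.ne'⟩))
    · rw [hgdvd p n hp, Nat.lcm_dvd_iff, not_and]
  have hA : ∀ n, n ∈ Nset Q ↔ ∃ m, n = L * m ∧ 0 < m ∧ ∀ i, ¬ f i ∣ m := by
    intro n
    constructor
    · intro h
      obtain ⟨⟨m, rfl⟩, h2⟩ := (hmem n h.1).1 h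
      refine ⟨m, rfl, Nat.pos_of_mul_pos_left h.1, fun i hi => h2 i i.2.1 i.2.2 ?_⟩
      exact (dvd_mul_iff_div_gcd_dvd (hdpos i i.2.1) L m).2 hi
    · rintro ⟨m, rfl, hm, h⟩
      refine (hmem _ (Nat.mul_pos hL hm)).2 ⟨dvd_mul_right L m, fun p hp hpQ hdvd => ?_⟩
      exact h ⟨p, hp, hpQ⟩ ((dvd_mul_iff_div_gcd_dvd (hdpos p hp) L m).1 hdvd)
  have hf2 : ∀ i, 2 ≤ f i := by
    intro i
    have h0 : 0 < f i := Nat.div_gcd_pos_of_pos_left L (hdpos i i.2.1)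
    have h1 : f i ≠ 1 := by
      intro h1
      obtain ⟨n, hn⟩ := hne
      obtain ⟨m, -, -, h⟩ := (hA n).1 hn
      exact h i (h1 ▸ one_dvd m)
    omega
  have hbound : ∀ i : {p : ℕ // p.Prime ∧ ¬ p ∣ Q}, (i : ℕ) ^ 2 ≤ 2 * L * Q * f i := by
    rintro ⟨p, hp, hpQ⟩
    have h1 : p - 1 ≤ g p * Q := by
      calc p - 1 = g p * (p - 1).gcd Q := (Nat.div_mul_cancel (Nat.gcd_dvd_left _ _)).symm
        _ ≤ g p * Q := Nat.mul_le_mul_left _ (Nat.gcd_le_right _ hQ)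
    have h2 : d p ≤ f ⟨p, hp, hpQ⟩ * L := by
      calc d p = d p / (d p).gcd L * (d p).gcd L :=
          (Nat.div_mul_cancel (Nat.gcd_dvd_left _ _)).symm
        _ ≤ d p / (d p).gcd L * L := Nat.mul_le_mul_left _ (Nat.gcd_le_right _ hL)
    have hcop : p.Coprime (g p) := by
      rw [Nat.Prime.coprime_iff_not_dvd hp]
      intro h
      have h3 := Nat.le_of_dvd (hgpos p hp) h
      have h4 : g p ≤ p - 1 := Nat.div_le_self _ _
      have := hp.pos
      omega
    have h3 : d p = p * g p := hcop.lcm_eq_mul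
    have h4 : p ≤ 2 * (p - 1) := by
      have := hp.two_le
      omega
    calc p ^ 2 = p * p := sq p
      _ ≤ p * (2 * (g p * Q)) := Nat.mul_le_mul_left p (h4.trans (Nat.mul_le_mul_left 2 h1))
      _ = 2 * Q * d p := by rw [h3]; ring
      _ ≤ 2 * Q * (f ⟨p, hp, hpQ⟩ * L) := Nat.mul_le_mul_left _ h2
      _ = _ := by ring
  have hsum : Summable fun i => (1 / f i : ℝ) := by
    have h1 : Summable fun i : {p : ℕ // p.Prime ∧ ¬ p ∣ Q} =>
        (2 * L * Q : ℝ) * (1 / ((i : ℕ) : ℝ) ^ 2) :=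
      ((Real.summable_one_div_nat_pow.2 one_lt_two).comp_injective
        Subtype.val_injective).mul_left _
    refine h1.of_nonneg_of_le (fun i => by positivity) fun i => ?_
    have hp : (0 : ℝ) < (i : ℕ) := by exact_mod_cast i.2.1.pos
    have hfi : (0 : ℝ) < f i := by exact_mod_cast lt_of_lt_of_le two_pos (hf2 i)
    rw [mul_one_div, div_le_div_iff₀ hfi (by positivity), one_mul]
    exact_mod_cast hbound i
  obtain ⟨δ, hδ, ht⟩ := exists_pos_tendsto_sieveCount_univ_div hf2 hsum
  exact ⟨δ * (1 / L), hasDensity_of_mem_iff hL hA ht, by positivity⟩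
end
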